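/- (Projection lemma, second inequality.) Let ℋ be a complex Hilbert space and let P, Q be bounded self-adjoint idempotent operators (orthogonal projections) on ℋ. Let g ∈ ℋ satisfy Qg = g and Pg ≠ g. Then ‖Pg‖² ≥ ‖g‖² · ‖(I − Q)(I − P)g‖² / ‖(I − P)g‖², where I denotes the identity operator (the denominator ‖(I − P)g‖² is nonzero since Pg ≠ g). -/

import Mathlib

lemma proj_orth_aux {H : Type*} [NormedAddCommGroup H] [InnerProductSpace ℂ H] [CompleteSpace H]
    (P : H →L[ℂ] H) (hP : IsSelfAdjoint P) (hP2 : P ∘L P = P) (x : H) :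
    inner ℂ (P x) (x - P x) = 0 := by
  have hs : inner ℂ (P x) (x - P x) = inner ℂ x (P (x - P x)) := hP.isSymmetric x (x - P x)
  have h2 : P (P x) = P x := congrArg (fun T : H →L[ℂ] H => T x) hP2
  rw [hs, map_sub, h2, sub_self, inner_zero_right]

lemma proj_pyth_aux {H : Type*} [NormedAddCommGroup H] [InnerProductSpace ℂ H] [CompleteSpace H]
    (P : H →L[ℂ] H) (hP : IsSelfAdjoint P) (hP2 : P ∘L P = P) (x : H) :
    ‖x‖ ^ 2 = ‖P x‖ ^ 2 + ‖x - P x‖ ^ 2 := by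
  have h := norm_add_sq_eq_norm_sq_add_norm_sq_of_inner_eq_zero (P x) (x - P x)
    (proj_orth_aux P hP hP2 x)
  rw [add_sub_cancel] at h
  nlinarith [h]

/-- **Projection lemma, second inequality.**
If `P, Q` are orthogonal projections on a complex Hilbert space `ℋ` and `g` satisfies
`Qg = g` and `Pg ≠ g`, then `‖Pg‖² ≥ ‖g‖² ‖(I − Q)(I − P)g‖² / ‖(I − P)g‖²`. -/
theorem projection_lemma_second
    {H : Type*} [NormedAddCommGroup H] [InnerProductSpace ℂ H] [CompleteSpace H]
    (P Q : H →L[ℂ] H)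
    (hP : IsSelfAdjoint P) (hP2 : P ∘L P = P)
    (hQ : IsSelfAdjoint Q) (hQ2 : Q ∘L Q = Q)
    (g : H) (hQg : Q g = g) (hPg : P g ≠ g) :
    ‖g‖ ^ 2 * ‖(ContinuousLinearMap.id ℂ H - Q) ((ContinuousLinearMap.id ℂ H - P) g)‖ ^ 2
        / ‖(ContinuousLinearMap.id ℂ H - P) g‖ ^ 2
      ≤ ‖P g‖ ^ 2 := by
  simp only [ContinuousLinearMap.sub_apply, ContinuousLinearMap.id_apply]
  have h1 := proj_pyth_aux P hP hP2 g
  have h3 := proj_orth_aux P hP hP2 g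
  have hpos : 0 < ‖g - P g‖ ^ 2 := by
    have : 0 < ‖g - P g‖ := norm_pos_iff.mpr (sub_ne_zero.mpr hPg.symm)
    positivity
  set u := g - P g with hu
  have h2 := proj_pyth_aux Q hQ hQ2 u
  have h4 : inner ℂ g (Q u) = inner ℂ u u := by
    have hs : inner ℂ (Q g) u = inner ℂ g (Q u) := hQ.isSymmetric g u
    have hg : g = P g + u := by rw [hu, add_sub_cancel]
    rw [← hs, hQg]
    nth_rewrite 1 [hg]
    rw [inner_add_left, h3, zero_add]
  have h5 : ‖u‖ ^ 2 ≤ ‖g‖ * ‖Q u‖ := by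
    have h := norm_inner_le_norm (𝕜 := ℂ) g (Q u)
    rw [h4, inner_self_eq_norm_sq_to_K] at h
    simpa using h
  have h6 : (‖u‖ ^ 2) ^ 2 ≤ ‖g‖ ^ 2 * ‖Q u‖ ^ 2 := by
    rw [← mul_pow]
    exact pow_le_pow_left₀ hpos.le h5 2
  rw [div_le_iff₀ hpos]
  have h7 : ‖u - Q u‖ ^ 2 = ‖u‖ ^ 2 - ‖Q u‖ ^ 2 := by linarith
  have h8 : ‖P g‖ ^ 2 = ‖g‖ ^ 2 - ‖u‖ ^ 2 := by linarith
  rw [h7, h8]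
  linarith
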